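/- arXiv:2402.00970 — 2 statements merged into one kernel-verified Lean document; each statement's English description precedes it below -/
import Mathlib

section
/- Let L be a logic interpreted over a set P of processes that features conjunction and is finitely characterized by a monotonic function B : P → Set L. Then every formula φ ∈ L is represented by some set S ⊆ P (i.e., there exists S ⊆ P whose elements are pairwise incomparable such that ⟦φ⟧ = ⋃_{p ∈ S} ↑p). -/
/-- `SatSet sem p` is the set `L(p)` of formulae satisfied by process `p`. -/
def SatSet {L P : Type*} (sem : L → Set P) (p : P) : Set L := {φ | p ∈ sem φ}

/-- The upwards closure `↑p = {q | L(p) ⊆ L(q)}`. -/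
def UpClos {L P : Type*} (sem : L → Set P) (p : P) : Set P :=
  {q | SatSet sem p ⊆ SatSet sem q}

/-- `φ` is characteristic for `p`. -/
def Characteristic {L P : Type*} (sem : L → Set P) (φ : L) (p : P) : Prop :=
  ∀ q, q ∈ sem φ ↔ SatSet sem p ⊆ SatSet sem q

/-- `φ` is consistent. -/
def Consistent {L P : Type*} (sem : L → Set P) (φ : L) : Prop := sem φ ≠ ∅

/-- `φ` is prime. -/
def IsPrime {L P : Type*} (sem : L → Set P) (φ : L) : Prop :=
  ∀ Ψ : Finset L, Ψ.Nonempty → sem φ ⊆ ⋃ ψ ∈ Ψ, sem ψ → ∃ ψ ∈ Ψ, sem φ ⊆ sem ψ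

/-- `p` and `q` are incomparable. -/
def Incomparable {L P : Type*} (sem : L → Set P) (p q : P) : Prop :=
  ¬ SatSet sem p ⊆ SatSet sem q ∧ ¬ SatSet sem q ⊆ SatSet sem p

/-- `S` (graphically) represents `φ`. -/
def Represents {L P : Type*} (sem : L → Set P) (S : Set P) (φ : L) : Prop :=
  S.Pairwise (Incomparable sem) ∧ sem φ = ⋃ p ∈ S, UpClos sem p

/-- `φ` is finitely represented. -/
def FinitelyRepresented {L P : Type*} (sem : L → Set P) (φ : L) : Prop :=
  ∃ S : Set P, S.Finite ∧ Represents sem S φ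

/-- A formula is decomposable. -/
def FormulaDecomposable {L P : Type*} (sem : L → Set P) (φ : L) : Prop :=
  ∃ (p : P) (χp ψ : L), Characteristic sem χp p ∧ p ∉ sem ψ ∧
    sem φ = sem χp ∪ sem ψ

/-- The logic is decomposable. -/
def LogicDecomposable {L P : Type*} (sem : L → Set P) : Prop :=
  ∀ φ, Consistent sem φ → FormulaDecomposable sem φ ∨ ∃ p, Characteristic sem φ p

/-- The logic features conjunction. -/
def FeaturesConj {L P : Type*} (sem : L → Set P) : Prop :=
  ∃ conj : L → L → L, ∀ φ ψ, sem (conj φ ψ) = sem φ ∩ sem ψ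

/-- The logic features disjunction. -/
def FeaturesDisj {L P : Type*} (sem : L → Set P) : Prop :=
  ∃ disj : L → L → L, ∀ φ ψ, sem (disj φ ψ) = sem φ ∪ sem ψ

/-- The logic is characterized by `B`. -/
def CharacterizedBy {L P : Type*} (sem : L → Set P) (B : P → Set L) : Prop :=
  ∀ p, (B p).Nonempty ∧ B p ⊆ SatSet sem p ∧
    ∀ φ ∈ SatSet sem p, (⋂ ψ ∈ B p, sem ψ) ⊆ sem φ

/-- The logic is finitely characterized by `B`. -/
def FinitelyCharacterizedBy {L P : Type*} (sem : L → Set P) (B : P → Set L) : Prop :=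
  CharacterizedBy sem B ∧ ∀ p, (B p).Finite

/-- `B` is monotonic. -/
def Monotonic {L P : Type*} (sem : L → Set P) (B : P → Set L) : Prop :=
  ∀ p q, SatSet sem p ⊆ SatSet sem q → B p ⊆ B q

/-- `p` is a minimal element of `S`. -/
def MinimalIn {L P : Type*} (sem : L → Set P) (S : Set P) (p : P) : Prop :=
  p ∈ S ∧ ∀ q ∈ S, SatSet sem q ⊆ SatSet sem p → SatSet sem q = SatSet sem p

/-- Inclusion of characterizing sets implies inclusion of the sets of satisfied formulae. -/
theorem CharacterizedBy.satSet_subset {L P : Type*} {sem : L → Set P} {B : P → Set L}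
    (hB : CharacterizedBy sem B) {p q : P} (h : B p ⊆ B q) : SatSet sem p ⊆ SatSet sem q :=
  fun ψ hψ => (hB p).2.2 ψ hψ (Set.mem_iInter₂.2 fun _ hχ => (hB q).2.1 (h hχ))

/-- Below every element of `S` there is a minimal element of `S`. -/
theorem exists_minimalIn_satSet_subset {L P : Type*} {sem : L → Set P} {B : P → Set L}
    (hB : FinitelyCharacterizedBy sem B) (hmono : Monotonic sem B) {S : Set P} {p : P}
    (hp : p ∈ S) : ∃ q, MinimalIn sem S q ∧ SatSet sem q ⊆ SatSet sem p := by
  obtain ⟨q, ⟨hqS, hqp⟩, hmin⟩ := (measure fun q => (B q).ncard).wf.has_min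
    {q | q ∈ S ∧ SatSet sem q ⊆ SatSet sem p} ⟨p, hp, subset_rfl⟩
  refine ⟨q, ⟨hqS, fun r hrS hrq => hrq.antisymm (hB.1.satSet_subset ?_)⟩, hqp⟩
  exact (Set.eq_of_subset_of_ncard_le (hmono r q hrq)
    (not_lt.1 (hmin r ⟨hrS, hrq.trans hqp⟩)) (hB.2 q)).ge

theorem stmt14 {L P : Type*} [Nonempty P] (sem : L → Set P)
    (hconj : FeaturesConj sem) (B : P → Set L)
    (hB : FinitelyCharacterizedBy sem B) (hmono : Monotonic sem B) (φ : L) :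
    ∃ S : Set P, Represents sem S φ := by
  obtain ⟨S, hS, hbij⟩ := Set.exists_subset_bijOn {p | MinimalIn sem (sem φ) p} (SatSet sem)
  refine ⟨S, fun p hp q hq hne => ⟨fun h => ?_, fun h => ?_⟩, Set.Subset.antisymm ?_ ?_⟩
  · exact hne (hbij.injOn hp hq ((hS hq).2 p (hS hp).1 h))
  · exact hne (hbij.injOn hp hq ((hS hp).2 q (hS hq).1 h).symm)
  · intro p hp
    obtain ⟨q, hq, hqp⟩ := exists_minimalIn_satSet_subset hB hmono hp
    obtain ⟨r, hr, hrq⟩ := hbij.surjOn ⟨q, hq, rfl⟩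
    exact Set.mem_iUnion₂.2 ⟨r, hr, hrq.le.trans hqp⟩
  · exact Set.iUnion₂_subset fun p hp q hq => hq (hS hp).1
end

section
/- Let L be a logic interpreted over a set P of processes that features conjunction, is finitely characterized by a monotonic function B : P → Set L, and is such that for each p ∈ P (with characteristic formula χ(p), which exists) there is a formula χ̄(p) ∈ L such that either ⟦χ̄(p)⟧ = P \ ⟦χ(p)⟧, or both p ∉ ⟦χ̄(p)⟧ and {q ∈ P | L(q) ⊄ L(p)} ⊆ ⟦χ̄(p)⟧. Then L is decomposable. -/
theorem FeaturesConj.exists_sem_eq_biInter {L P : Type*} {sem : L → Set P}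
    (hconj : FeaturesConj sem) {S : Set L} (hS : S.Nonempty) (hfin : S.Finite) :
    ∃ χ, sem χ = ⋂ ψ ∈ S, sem ψ := by
  obtain ⟨conj, hc⟩ := hconj
  induction S, hfin using Set.Finite.induction_on with
  | empty => exact absurd hS Set.not_nonempty_empty
  | @insert a T _ _ ih =>
    rcases T.eq_empty_or_nonempty with rfl | hT
    · exact ⟨a, by simp⟩
    · obtain ⟨χ, hχ⟩ := ih hT
      exact ⟨conj a χ, by rw [hc, hχ, Set.biInter_insert]⟩

theorem CharacterizedBy.satSet_subset_iff {L P : Type*} {sem : L → Set P} {B : P → Set L}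
    (hB : CharacterizedBy sem B) {p q : P} :
    SatSet sem p ⊆ SatSet sem q ↔ B p ⊆ SatSet sem q :=
  ⟨fun h => (hB p).2.1.trans h,
    fun h φ hφ => (hB p).2.2 φ hφ (Set.mem_iInter₂.2 fun _ hψ => h hψ)⟩

theorem FinitelyCharacterizedBy.exists_characteristic {L P : Type*} {sem : L → Set P}
    {B : P → Set L} (hB : FinitelyCharacterizedBy sem B) (hconj : FeaturesConj sem) (p : P) :
    ∃ χ, Characteristic sem χ p := by
  obtain ⟨χ, hχ⟩ := hconj.exists_sem_eq_biInter (hB.1 p).1 (hB.2 p)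
  refine ⟨χ, fun q => ?_⟩
  rw [hB.1.satSet_subset_iff, hχ, Set.mem_iInter₂]
  rfl

theorem FinitelyCharacterizedBy.exists_minimalIn {L P : Type*} {sem : L → Set P}
    {B : P → Set L} (hB : FinitelyCharacterizedBy sem B) (hmono : Monotonic sem B)
    {S : Set P} (hS : S.Nonempty) : ∃ p, MinimalIn sem S p := by
  obtain ⟨p, hp, hmin⟩ :=
    (measure fun p => (B p).ncard).wf.has_min S hS
  refine ⟨p, hp, fun q hq hqp => hqp.antisymm ?_⟩
  have hBB : B q = B p :=
    Set.eq_of_subset_of_ncard_le (hmono q p hqp) (not_lt.1 (hmin q hq)) (hB.2 p)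
  exact hB.1.satSet_subset_iff.2 (hBB ▸ (hB.1 q).2.1)

theorem stmt15 {L P : Type*} [Nonempty P] (sem : L → Set P)
    (hconj : FeaturesConj sem) (B : P → Set L)
    (hB : FinitelyCharacterizedBy sem B) (hmono : Monotonic sem B)
    (hbar : ∀ (p : P) (χp : L), Characteristic sem χp p →
      ∃ χbar : L, sem χbar = (sem χp)ᶜ ∨
        (p ∉ sem χbar ∧ {q : P | ¬ SatSet sem q ⊆ SatSet sem p} ⊆ sem χbar)) :
    LogicDecomposable sem := by
  intro φ hφ
  obtain ⟨p, hp, hmin⟩ := hB.exists_minimalIn hmono (Set.nonempty_iff_ne_empty.2 hφ)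
  obtain ⟨χ, hχ⟩ := hB.exists_characteristic hconj p
  obtain ⟨χbar, hχbar⟩ := hbar p χ hχ
  obtain ⟨conj, hc⟩ := hconj
  have hpχ : p ∈ sem χ := (hχ p).2 subset_rfl
  have hχφ : sem χ ⊆ sem φ := fun q hq => (hχ q).1 hq hp
  refine Or.inl ⟨p, χ, conj φ χbar, hχ, ?_, ?_⟩
  · rw [hc]
    rintro ⟨-, h⟩
    rcases hχbar with hcompl | ⟨hnot, -⟩
    · rw [hcompl] at h
      exact h hpχ
    · exact hnot h
  · rw [hc]
    refine Set.Subset.antisymm (fun q hq => ?_)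
      (Set.union_subset hχφ Set.inter_subset_left)
    by_cases hqχ : q ∈ sem χ
    · exact Or.inl hqχ
    · refine Or.inr ⟨hq, ?_⟩
      rcases hχbar with hcompl | ⟨-, hsub⟩
      · rwa [hcompl]
      · exact hsub fun hqp => hqχ ((hχ q).2 (hmin q hq hqp).superset)
end
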